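/- Let R > 0 and let γ be a rotation invariant measure on ℝⁿ with density f(|x|), f ∈ C²([0,∞)), and set A = ∫₀¹ t^{n−1} f(Rt) dt. Then the following are equivalent: (i) for every even strictly positive φ ∈ C²(𝕊ⁿ⁻¹), the function g(s) = γ(Q_s) along the family Q(R,φ,I) (where Q_s has support function R·φ^s) satisfies (d²/ds²) log g(s) |_{s=0} ≤ 0; (ii) for every even ψ ∈ C²(𝕊ⁿ⁻¹): A[n f(R) + R f'(R)]·(1/|𝕊ⁿ⁻¹|)∫_{𝕊ⁿ⁻¹} ψ² du − A f(R)·(1/|𝕊ⁿ⁻¹|)∫_{𝕊ⁿ⁻¹} |∇_σψ|² du ≤ f(R)² · ((1/|𝕊ⁿ⁻¹|)∫_{𝕊ⁿ⁻¹} ψ du)². -/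

import Mathlib

open MeasureTheory Metric Set Pointwise
open scoped ENNReal RealInnerProductSpace

noncomputable section

/-- The convex body determined by a function `f` on the sphere (the Wulff shape). -/
def bodyOf {n : ℕ} (f : EuclideanSpace ℝ (Fin n) → ℝ) : Set (EuclideanSpace ℝ (Fin n)) :=
  {x | ∀ u ∈ sphere (0 : EuclideanSpace ℝ (Fin n)) 1, ⟪x, u⟫ ≤ f u}

/-- The spherical gradient of `ψ` at a unit vector `u`: the tangential component of the
ambient gradient. -/
def sphGrad {n : ℕ} (ψ : EuclideanSpace ℝ (Fin n) → ℝ) (u : EuclideanSpace ℝ (Fin n)) :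
    EuclideanSpace ℝ (Fin n) :=
  gradient ψ u - ⟪gradient ψ u, u⟫ • u

section ContactPoints

open Filter Topology

variable {n : ℕ}

local notation "𝔼" => EuclideanSpace ℝ (Fin n)
local notation "𝕊" => sphere (0 : EuclideanSpace ℝ (Fin n)) 1

/-- `u` is a normal direction at which the ray through `v` leaves the body with support
data `exp (s * ψ)`. -/
def IsContact (ψ : EuclideanSpace ℝ (Fin n) → ℝ) (s : ℝ)
    (v u : sphere (0 : EuclideanSpace ℝ (Fin n)) 1) : Prop :=
  0 < ⟪(u : 𝔼), (v : 𝔼)⟫ ∧ ∀ w : 𝕊,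
    ⟪(w : 𝔼), (v : 𝔼)⟫ * Real.exp (-(s * ψ w)) ≤ ⟪(u : 𝔼), (v : 𝔼)⟫ * Real.exp (-(s * ψ u))

theorem exists_isContact {ψ : 𝔼 → ℝ} (hψ : Continuous ψ) (s : ℝ) (v : 𝕊) :
    ∃ u, IsContact ψ s v u := by
  have hc : Continuous fun w : 𝕊 ↦ ⟪(w : 𝔼), (v : 𝔼)⟫ * Real.exp (-(s * ψ w)) := by fun_prop
  obtain ⟨u, -, hu⟩ := isCompact_univ.exists_isMaxOn ⟨v, mem_univ v⟩ hc.continuousOn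
  have hu' : ∀ w : 𝕊, ⟪(w : 𝔼), (v : 𝔼)⟫ * Real.exp (-(s * ψ w)) ≤
      ⟪(u : 𝔼), (v : 𝔼)⟫ * Real.exp (-(s * ψ u)) := fun w ↦ hu (mem_univ w)
  refine ⟨u, ?_, hu'⟩
  have h1 := hu' v
  rw [real_inner_self_eq_norm_sq, norm_eq_of_mem_sphere v] at h1
  have h2 := Real.exp_pos (-(s * ψ v))
  by_contra! h3
  nlinarith [Real.exp_pos (-(s * ψ u)), mul_nonpos_of_nonpos_of_nonneg h3
    (Real.exp_pos (-(s * ψ u))).le]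

theorem inner_sphGrad_self (ψ : 𝔼 → ℝ) (u : 𝕊) : ⟪(u : 𝔼), sphGrad ψ u⟫ = 0 := by
  rw [sphGrad, inner_sub_right, inner_smul_right, real_inner_self_eq_norm_sq,
    norm_eq_of_mem_sphere u, real_inner_comm]
  ring

theorem contDiff_sphGrad {ψ : 𝔼 → ℝ} (hψ : ContDiff ℝ 2 ψ) : ContDiff ℝ 1 (sphGrad ψ) := by
  have h1 : ContDiff ℝ 1 (gradient ψ) := by
    have : ContDiff ℝ 1 (fderiv ℝ ψ) := hψ.fderiv_right (by norm_num)
    exact (InnerProductSpace.toDual ℝ 𝔼).symm.contDiff.comp this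
  unfold sphGrad
  exact h1.sub ((h1.inner ℝ contDiff_id).smul contDiff_id)

/-- The first order condition at a contact point. -/
theorem IsContact.eq_smul {ψ : 𝔼 → ℝ} (hψ : ContDiff ℝ 2 ψ) {s : ℝ} {v u : 𝕊}
    (h : IsContact ψ s v u) :
    (v : 𝔼) = ⟪(u : 𝔼), (v : 𝔼)⟫ • ((u : 𝔼) + s • sphGrad ψ u) := by
  have hu1 : ‖(u : 𝔼)‖ = 1 := norm_eq_of_mem_sphere u
  set m : 𝔼 → ℝ := fun x ↦ ⟪x, (v : 𝔼)⟫ * Real.exp (-(s * ψ x)) with hm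
  have hmd : ContDiff ℝ 1 m := by
    have := hψ.of_le (m := 1) (by norm_num)
    exact (contDiff_id.inner ℝ contDiff_const).mul (contDiff_const.mul this).neg.exp
  have hms : HasStrictFDerivAt m (fderiv ℝ m u) u :=
    hmd.contDiffAt.hasStrictFDerivAt (by norm_num)
  have hext : IsLocalExtrOn m {x | ‖x‖ ^ 2 = ‖(u : 𝔼)‖ ^ 2} u := by
    refine Or.inr (IsMaxOn.localize fun x hx ↦ ?_)
    have hx' : ‖x‖ ^ 2 = ‖(u : 𝔼)‖ ^ 2 := hx
    rw [hu1] at hx'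
    have hx1 : ‖x‖ = 1 := by nlinarith [norm_nonneg x]
    exact h.2 ⟨x, by simpa using hx1⟩
  obtain ⟨a, b, hab, heq⟩ := hext.exists_multipliers_of_hasStrictFDerivAt_1d
    (hasStrictFDerivAt_norm_sq (u : 𝔼)) hms
  have hψd : HasGradientAt ψ (gradient ψ u) u :=
    (hψ.differentiable (by norm_num) _).hasGradientAt
  have hm' : ∀ w, fderiv ℝ m u w =
      Real.exp (-(s * ψ u)) * (⟪w, (v : 𝔼)⟫ - s * ⟪(u : 𝔼), (v : 𝔼)⟫ * ⟪gradient ψ u, w⟫) := by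
    intro w
    have h1 : HasFDerivAt (fun x : 𝔼 ↦ ⟪x, (v : 𝔼)⟫) (innerSL ℝ (v : 𝔼)) (u : 𝔼) := by
      simpa [real_inner_comm] using (innerSL ℝ (v : 𝔼)).hasFDerivAt (x := (u : 𝔼))
    have h2 := ((hψd.hasFDerivAt.const_mul s).neg).exp
    have h3 : HasFDerivAt m _ (u : 𝔼) := h1.mul h2
    rw [h3.fderiv]
    simp [real_inner_comm]
    ring
  have heq' : ∀ w, a * (2 * ⟪(u : 𝔼), w⟫) + b * fderiv ℝ m u w = 0 := by
    intro w
    have := congrArg (fun L ↦ L w) heq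
    simpa using this
  have hb : b ≠ 0 := by
    rintro rfl
    have := heq' u
    rw [real_inner_self_eq_norm_sq, hu1] at this
    apply hab
    ext
    · simp only [Prod.fst_zero]
      linarith
    · rfl
  have hE := Real.exp_pos (-(s * ψ u))
  set p := ⟪(u : 𝔼), (v : 𝔼)⟫ with hp
  set c : ℝ := -(a * 2) / (b * Real.exp (-(s * ψ u))) with hc
  have key : ∀ w, ⟪w, (v : 𝔼)⟫ - s * p * ⟪gradient ψ u, w⟫ = c * ⟪(u : 𝔼), w⟫ := by
    intro w
    have := heq' w
    rw [hm'] at this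
    rw [hc]
    field_simp
    linarith
  have hcp : c = p - s * p * ⟪gradient ψ u, (u : 𝔼)⟫ := by
    have := key u
    rw [real_inner_self_eq_norm_sq, hu1] at this
    linarith
  apply ext_inner_right ℝ
  intro w
  have := key w
  rw [hcp] at this
  rw [real_inner_comm]
  simp only [sphGrad, inner_smul_left, inner_add_left, inner_sub_left, RCLike.conj_to_real]
  linarith

theorem IsContact.inner_mul_sqrt {ψ : 𝔼 → ℝ} (hψ : ContDiff ℝ 2 ψ) {s : ℝ} {v u : 𝕊}
    (h : IsContact ψ s v u) :
    ⟪(u : 𝔼), (v : 𝔼)⟫ * √(1 + ‖s • sphGrad ψ u‖ ^ 2) = 1 := by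
  have h1 := congrArg norm (h.eq_smul hψ)
  rw [norm_eq_of_mem_sphere v, norm_smul, Real.norm_of_nonneg h.1.le] at h1
  have h2 : ‖(u : 𝔼) + s • sphGrad ψ u‖ ^ 2 = 1 + ‖s • sphGrad ψ u‖ ^ 2 := by
    rw [norm_add_sq_real, inner_smul_right, inner_sphGrad_self, norm_eq_of_mem_sphere u]
    ring
  rw [← h2, Real.sqrt_sq (norm_nonneg _), ← h1]

theorem IsContact.eq_sub {ψ : 𝔼 → ℝ} (hψ : ContDiff ℝ 2 ψ) {s : ℝ} {v u : 𝕊}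
    (h : IsContact ψ s v u) :
    (u : 𝔼) = √(1 + ‖s • sphGrad ψ u‖ ^ 2) • (v : 𝔼) - s • sphGrad ψ u := by
  have h1 := h.inner_mul_sqrt hψ
  have h2 := congrArg (fun x ↦ √(1 + ‖s • sphGrad ψ u‖ ^ 2) • x) (h.eq_smul hψ)
  simp only [smul_smul] at h2
  rw [mul_comm, h1, one_smul] at h2
  rw [h2, add_sub_cancel_right]

theorem IsContact.eq_of_zero {ψ : 𝔼 → ℝ} (hψ : ContDiff ℝ 2 ψ) {v u : 𝕊}
    (h : IsContact ψ 0 v u) : u = v := by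
  have := h.eq_sub hψ
  ext1
  simpa using this

theorem abs_sqrt_one_add_sq_sub_le (a b : ℝ) : |√(1 + a ^ 2) - √(1 + b ^ 2)| ≤ |a - b| := by
  have ha := Real.sq_sqrt (show 0 ≤ 1 + a ^ 2 by positivity)
  have hb := Real.sq_sqrt (show 0 ≤ 1 + b ^ 2 by positivity)
  have hab : 1 + a * b ≤ √(1 + a ^ 2) * √(1 + b ^ 2) := by
    rw [← Real.sqrt_mul (by positivity)]
    apply Real.le_sqrt_of_sq_le
    nlinarith [sq_nonneg (a - b)]
  apply sq_le_sq.mp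
  nlinarith

/-- For small parameters, contact points depend in a Lipschitz way on the parameter and on
the direction. -/
theorem exists_norm_contact_sub_le {ψ : 𝔼 → ℝ} (hψ : ContDiff ℝ 2 ψ) :
    ∃ δ > 0, ∃ C : ℝ, 0 ≤ C ∧ ∀ s s' : ℝ, |s| ≤ δ → |s'| ≤ δ → ∀ v v' u u' : 𝕊,
      IsContact ψ s v u → IsContact ψ s' v' u' →
      ‖(u : 𝔼) - u'‖ ≤ C * (|s - s'| + ‖(v : 𝔼) - v'‖) := by
  obtain ⟨L, hL⟩ := ((contDiff_sphGrad hψ).locallyLipschitz.locallyLipschitzOn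
    ).exists_lipschitzOnWith_of_compact (isCompact_sphere (0 : 𝔼) 1)
  obtain ⟨M, hM⟩ := (isCompact_sphere (0 : 𝔼) 1).exists_bound_of_continuousOn
    (contDiff_sphGrad hψ).continuous.continuousOn
  set M' := max M 0
  have hM' : ∀ u : 𝕊, ‖sphGrad ψ u‖ ≤ M' := fun u ↦ (hM u u.2).trans (le_max_left _ _)
  have hM0 : 0 ≤ M' := le_max_right _ _
  have hL0 : (0 : ℝ) ≤ L := L.2
  have hδ : 0 < 1 / (4 * ((L : ℝ) + 1)) := by positivity
  refine ⟨1 / (4 * (L + 1)), hδ, 4 * M' + 2 * (1 + M'), by positivity, ?_⟩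
  intro s s' hs hs' v v' u u' h h'
  have hδL : 1 / (4 * ((L : ℝ) + 1)) * L ≤ 1 / 4 := by
    rw [div_mul_eq_mul_div, div_le_div_iff₀ (by positivity) (by positivity)]
    nlinarith
  have hδ1 : 1 / (4 * ((L : ℝ) + 1)) ≤ 1 := by
    rw [div_le_one (by positivity)]
    linarith
  set g := s • sphGrad ψ u with hg
  set g' := s' • sphGrad ψ u' with hg'
  have hgg : ‖g - g'‖ ≤ |s - s'| * M' + 1 / 4 * ‖(u : 𝔼) - u'‖ := by
    have e : g - g' = (s - s') • sphGrad ψ u + s' • (sphGrad ψ u - sphGrad ψ u') := by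
      rw [hg, hg']
      module
    rw [e]
    refine (norm_add_le _ _).trans ?_
    rw [norm_smul, norm_smul, Real.norm_eq_abs, Real.norm_eq_abs]
    have hl : ‖sphGrad ψ u - sphGrad ψ u'‖ ≤ L * ‖(u : 𝔼) - u'‖ := by
      simpa [dist_eq_norm] using hL.dist_le_mul u u.2 u' u'.2
    refine add_le_add (mul_le_mul_of_nonneg_left (hM' u) (abs_nonneg _)) ?_
    · calc |s'| * ‖sphGrad ψ u - sphGrad ψ u'‖
          ≤ 1 / (4 * ((L : ℝ) + 1)) * (L * ‖(u : 𝔼) - u'‖) := by gcongr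
        _ = 1 / (4 * ((L : ℝ) + 1)) * L * ‖(u : 𝔼) - u'‖ := by ring
        _ ≤ _ := by gcongr
  have hq : |√(1 + ‖g‖ ^ 2) - √(1 + ‖g'‖ ^ 2)| ≤ ‖g - g'‖ :=
    (abs_sqrt_one_add_sq_sub_le _ _).trans (abs_norm_sub_norm_le _ _)
  have hsq : √(1 + ‖g'‖ ^ 2) ≤ 1 + M' := by
    apply Real.sqrt_le_iff.mpr ⟨by positivity, ?_⟩
    have : ‖g'‖ ≤ M' := by
      rw [hg', norm_smul, Real.norm_eq_abs]
      calc |s'| * ‖sphGrad ψ u'‖ ≤ 1 * M' := by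
            gcongr
            exacts [hs'.trans hδ1, hM' u']
        _ = M' := one_mul _
    nlinarith [norm_nonneg g']
  have e : (u : 𝔼) - u' = (√(1 + ‖g‖ ^ 2) - √(1 + ‖g'‖ ^ 2)) • (v : 𝔼)
      + √(1 + ‖g'‖ ^ 2) • ((v : 𝔼) - v') - (g - g') := by
    rw [h.eq_sub hψ, h'.eq_sub hψ]
    module
  have hfin : ‖(u : 𝔼) - u'‖ ≤ ‖g - g'‖ + (1 + M') * ‖(v : 𝔼) - v'‖ + ‖g - g'‖ := by
    conv_lhs => rw [e]
    refine (norm_sub_le _ _).trans ?_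
    refine add_le_add_left ((norm_add_le _ _).trans ?_) _
    rw [norm_smul _ (v : 𝔼), norm_smul _ ((v : 𝔼) - v'), norm_eq_of_mem_sphere v, mul_one,
      Real.norm_eq_abs, Real.norm_of_nonneg (Real.sqrt_nonneg _)]
    gcongr
  have h1 := norm_nonneg ((v : 𝔼) - v')
  have h2 := abs_nonneg (s - s')
  nlinarith [mul_nonneg hM0 h1, mul_nonneg hM0 h2]

end ContactPoints

section PolarCoordinates

variable {n : ℕ}

theorem isClosed_bodyOf (h : EuclideanSpace ℝ (Fin n) → ℝ) : IsClosed (bodyOf h) := by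
  simp only [bodyOf, ofPred_forall]
  exact isClosed_biInter fun u _ ↦ isClosed_le (by fun_prop) continuous_const

theorem lintegral_volumeIoiPow_indicator (k : ℕ) {f : ℝ → ℝ} (hf : Continuous f)
    (hf0 : ∀ t, 0 ≤ f t) {ρ : ℝ} (hρ : 0 < ρ) :
    ∫⁻ r : Ioi (0 : ℝ), (Iic ρ).indicator (fun t ↦ ENNReal.ofReal (f t)) r
      ∂(Measure.volumeIoiPow k) = ENNReal.ofReal (∫ r in (0 : ℝ)..ρ, r ^ k * f r) := by
  have hm : Measurable ((Iic ρ).indicator fun t ↦ ENNReal.ofReal (f t)) :=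
    hf.measurable.ennreal_ofReal.indicator measurableSet_Iic
  have hp : Measurable fun r : Ioi (0 : ℝ) ↦ ENNReal.ofReal ((r : ℝ) ^ k) := by fun_prop
  have hm' : Measurable fun r : Ioi (0 : ℝ) ↦
      (Iic ρ).indicator (fun t ↦ ENNReal.ofReal (f t)) (r : ℝ) := hm.comp measurable_subtype_coe
  rw [Measure.volumeIoiPow, lintegral_withDensity_eq_lintegral_mul _ hp hm']
  rw [show (∫⁻ a : Ioi (0 : ℝ), ((fun r : Ioi (0 : ℝ) ↦ ENNReal.ofReal ((r : ℝ) ^ k)) *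
      (fun r : Ioi (0 : ℝ) ↦ (Iic ρ).indicator (fun t ↦ ENNReal.ofReal (f t)) (r : ℝ))) a
        ∂(Measure.comap Subtype.val volume)) =
      ∫⁻ a in Ioi (0 : ℝ), ENNReal.ofReal (a ^ k) *
        (Iic ρ).indicator (fun t ↦ ENNReal.ofReal (f t)) a from
    lintegral_subtype_comap measurableSet_Ioi (fun a : ℝ ↦ ENNReal.ofReal (a ^ k) *
        (Iic ρ).indicator (fun t ↦ ENNReal.ofReal (f t)) a)]
  rw [intervalIntegral.integral_of_le hρ.le, ofReal_integral_eq_lintegral_ofReal]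
  · rw [← lintegral_indicator measurableSet_Ioi, ← lintegral_indicator measurableSet_Ioc]
    congr 1 with a
    by_cases h0 : 0 < a <;> by_cases h1 : a ≤ ρ <;>
      simp [h0, h1, indicator]
    rw [ENNReal.ofReal_mul (by positivity)]
  · exact ((by fun_prop : Continuous fun r : ℝ ↦ r ^ k * f r).intervalIntegrable 0 ρ).1
  · filter_upwards [ae_restrict_mem measurableSet_Ioc] with r hr
    exact mul_nonneg (pow_nonneg hr.1.le _) (hf0 r)

/-- The measure of a star body with respect to a rotation invariant density, in polar
coordinates. -/
theorem toReal_withDensity_eq_integral_sphere {f : ℝ → ℝ} (hf : Continuous f)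
    (hf0 : ∀ t, 0 ≤ f t) (hn : n ≠ 0) {K : Set (EuclideanSpace ℝ (Fin n))} (hK : MeasurableSet K)
    {ρ : sphere (0 : EuclideanSpace ℝ (Fin n)) 1 → ℝ} (hρ : Continuous ρ) (hρ0 : ∀ v, 0 < ρ v)
    (hKρ : ∀ (v : sphere (0 : EuclideanSpace ℝ (Fin n)) 1) (r : ℝ), 0 < r →
      (r • (v : EuclideanSpace ℝ (Fin n)) ∈ K ↔ r ≤ ρ v)) :
    (((volume : Measure (EuclideanSpace ℝ (Fin n))).withDensity
      fun x ↦ ENNReal.ofReal (f ‖x‖)) K).toReal =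
    ∫ v, (∫ r in (0 : ℝ)..ρ v, r ^ (n - 1) * f r)
      ∂((volume : Measure (EuclideanSpace ℝ (Fin n))).toSphere) := by
  have : Nonempty (Fin n) := ⟨⟨0, Nat.pos_of_ne_zero hn⟩⟩
  have hc : Continuous fun y : ℝ ↦ ∫ r in (0 : ℝ)..y, r ^ (n - 1) * f r :=
    intervalIntegral.continuous_primitive
      (fun a b ↦ (by fun_prop : Continuous fun r : ℝ ↦ r ^ (n - 1) * f r).intervalIntegrable a b) 0
  have hJ := hc.comp hρ
  rw [withDensity_apply _ hK, integral_eq_lintegral_of_nonneg_ae]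
  rotate_left
  · refine Filter.Eventually.of_forall fun v ↦ ?_
    exact intervalIntegral.integral_nonneg (hρ0 v).le
      fun r hr ↦ mul_nonneg (pow_nonneg hr.1 _) (hf0 r)
  · exact hJ.aestronglyMeasurable
  congr 1
  set F : EuclideanSpace ℝ (Fin n) → ℝ≥0∞ := K.indicator fun x ↦ ENNReal.ofReal (f ‖x‖) with hF
  have hFm : Measurable F :=
    (by fun_prop : Measurable fun x : EuclideanSpace ℝ (Fin n) ↦
      ENNReal.ofReal (f ‖x‖)).indicator hK
  have hdim : Module.finrank ℝ (EuclideanSpace ℝ (Fin n)) = n := by simp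
  have hmp := (volume : Measure (EuclideanSpace ℝ (Fin n))).measurePreserving_homeomorphUnitSphereProd
  have hG : Measurable fun p : sphere (0 : EuclideanSpace ℝ (Fin n)) 1 × Ioi (0 : ℝ) ↦
      F ((p.2 : ℝ) • (p.1 : EuclideanSpace ℝ (Fin n))) := by fun_prop
  calc ∫⁻ x in K, ENNReal.ofReal (f ‖x‖)
      = ∫⁻ x, F x := (lintegral_indicator hK _).symm
    _ = ∫⁻ x in ({0}ᶜ : Set (EuclideanSpace ℝ (Fin n))), F x := by rw [restrict_compl_singleton]
    _ = ∫⁻ x : ({0}ᶜ : Set (EuclideanSpace ℝ (Fin n))), F x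
          ∂((volume : Measure (EuclideanSpace ℝ (Fin n))).comap (↑)) :=
        (lintegral_subtype_comap (measurableSet_singleton _).compl F).symm
    _ = ∫⁻ p, F ((p.2 : ℝ) • (p.1 : EuclideanSpace ℝ (Fin n)))
          ∂((volume : Measure (EuclideanSpace ℝ (Fin n))).toSphere.prod
            (Measure.volumeIoiPow (Module.finrank ℝ (EuclideanSpace ℝ (Fin n)) - 1))) := by
        rw [← hmp.lintegral_comp hG]
        refine lintegral_congr fun x ↦ ?_
        have hx : ‖(x : EuclideanSpace ℝ (Fin n))‖ ≠ 0 := norm_ne_zero_iff.mpr x.2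
        simp [smul_smul, hx]
    _ = ∫⁻ v, ∫⁻ r, F ((r : ℝ) • (v : EuclideanSpace ℝ (Fin n)))
          ∂(Measure.volumeIoiPow (Module.finrank ℝ (EuclideanSpace ℝ (Fin n)) - 1))
          ∂((volume : Measure (EuclideanSpace ℝ (Fin n))).toSphere) :=
        lintegral_prod _ hG.aemeasurable
    _ = _ := by
        refine lintegral_congr fun v ↦ ?_
        rw [hdim, ← lintegral_volumeIoiPow_indicator (n - 1) hf hf0 (hρ0 v)]
        refine lintegral_congr fun r ↦ ?_
        have hr : (0 : ℝ) < r := r.2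
        simp [hF, indicator, hKρ v r hr, norm_smul, abs_of_pos hr]

end PolarCoordinates

section RadialFunction

open Filter Topology

variable {n : ℕ}

local notation "𝔼" => EuclideanSpace ℝ (Fin n)
local notation "𝕊" => sphere (0 : EuclideanSpace ℝ (Fin n)) 1

/-- The logarithm of `exp (s * ψ u) / ⟪u, v⟫`. At a contact point `u` this is the logarithmic
radial function in direction `v` of the body with support data `exp (s * ψ)`. -/
def logRadial (ψ : EuclideanSpace ℝ (Fin n) → ℝ) (s : ℝ)
    (v u : sphere (0 : EuclideanSpace ℝ (Fin n)) 1) : ℝ :=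
  s * ψ u - Real.log ⟪(u : 𝔼), (v : 𝔼)⟫

theorem exp_logRadial {ψ : 𝔼 → ℝ} {s : ℝ} {v u : 𝕊} (h : 0 < ⟪(u : 𝔼), (v : 𝔼)⟫) :
    Real.exp (logRadial ψ s v u) = Real.exp (s * ψ u) / ⟪(u : 𝔼), (v : 𝔼)⟫ := by
  rw [logRadial, Real.exp_sub, Real.exp_log h]

theorem IsContact.logRadial_le {ψ : 𝔼 → ℝ} {s : ℝ} {v u w : 𝕊} (h : IsContact ψ s v u)
    (hw : 0 < ⟪(w : 𝔼), (v : 𝔼)⟫) : logRadial ψ s v u ≤ logRadial ψ s v w := by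
  rw [← Real.exp_le_exp, exp_logRadial h.1, exp_logRadial hw, div_le_div_iff₀ h.1 hw]
  have := h.2 w
  rw [Real.exp_neg, Real.exp_neg, ← div_eq_mul_inv, ← div_eq_mul_inv,
    div_le_div_iff₀ (Real.exp_pos _) (Real.exp_pos _)] at this
  linarith

theorem IsContact.smul_mem_bodyOf_iff {ψ : 𝔼 → ℝ} {s R r : ℝ} {v u : 𝕊}
    (h : IsContact ψ s v u) (hR : 0 < R) (hr : 0 < r) :
    r • (v : 𝔼) ∈ bodyOf (fun w ↦ R * Real.exp (s * ψ w)) ↔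
      r ≤ R * Real.exp (logRadial ψ s v u) := by
  have hmem : r • (v : 𝔼) ∈ bodyOf (fun w ↦ R * Real.exp (s * ψ w)) ↔
      ∀ w : 𝕊, r * ⟪(w : 𝔼), (v : 𝔼)⟫ ≤ R * Real.exp (s * ψ w) := by
    simp only [bodyOf, mem_ofPred_eq, inner_smul_left, RCLike.conj_to_real, Subtype.forall]
    refine forall₂_congr fun w _ ↦ ?_
    rw [real_inner_comm]
  rw [hmem]
  constructor
  · intro hw
    rw [exp_logRadial h.1, mul_div_assoc', le_div_iff₀ h.1]
    exact hw u
  · intro hle w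
    rcases le_or_gt ⟪(w : 𝔼), (v : 𝔼)⟫ 0 with hw | hw
    · exact (mul_nonpos_of_nonneg_of_nonpos hr.le hw).trans (by positivity)
    · have h1 : r ≤ R * Real.exp (logRadial ψ s v w) := by
        grw [hle, h.logRadial_le hw]
      rwa [exp_logRadial hw, mul_div_assoc', le_div_iff₀ hw] at h1

/-- The envelope inequality for the logarithmic radial function. -/
theorem IsContact.logRadial_sub_le {ψ : 𝔼 → ℝ} {s s' : ℝ} {v u u' : 𝕊}
    (h : IsContact ψ s v u) (h' : IsContact ψ s' v u') :
    logRadial ψ s' v u' - logRadial ψ s v u ≤ (s' - s) * ψ u := by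
  have := h'.logRadial_le h.1
  simp only [logRadial] at this ⊢
  linarith

theorem IsContact.logRadial_of_zero {ψ : 𝔼 → ℝ} (hψ : ContDiff ℝ 2 ψ) {v u : 𝕊}
    (h : IsContact ψ 0 v u) : logRadial ψ 0 v u = 0 := by
  rw [h.eq_of_zero hψ, logRadial, real_inner_self_eq_norm_sq, norm_eq_of_mem_sphere v]
  simp

theorem hasDerivAt_of_envelope {L p : ℝ → ℝ} {s : ℝ} (hp : ContinuousAt p s)
    (h : ∀ᶠ t in 𝓝 s, (t - s) * p t ≤ L t - L s ∧ L t - L s ≤ (t - s) * p s) :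
    HasDerivAt L (p s) s := by
  rw [hasDerivAt_iff_isLittleO]
  have h0 : (fun t ↦ (t - s) * (p t - p s)) =o[𝓝 s] fun t ↦ t - s := by
    have h1 : (fun t ↦ p t - p s) =o[𝓝 s] fun _ ↦ (1 : ℝ) := by
      rw [Asymptotics.isLittleO_one_iff]
      simpa using hp.tendsto.sub_const (p s)
    simpa using (Asymptotics.isBigO_refl (fun t ↦ t - s) (𝓝 s)).mul_isLittleO h1
  refine Asymptotics.IsBigO.trans_isLittleO (Asymptotics.IsBigO.of_bound 1 ?_) h0
  filter_upwards [h] with t ht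
  rw [one_mul, Real.norm_eq_abs, Real.norm_eq_abs, smul_eq_mul,
    abs_of_nonpos (by linarith : L t - L s - (t - s) * p s ≤ 0),
    abs_of_nonpos (by linarith : (t - s) * (p t - p s) ≤ 0)]
  linarith

/-- The velocity of the contact point at parameter zero is minus the spherical gradient. -/
theorem hasDerivAt_contact {ψ : 𝔼 → ℝ} (hψ : ContDiff ℝ 2 ψ) {U : ℝ → 𝕊} {v : 𝕊}
    (hU : ∀ s, IsContact ψ s v (U s)) (hc : ContinuousAt (fun s ↦ (U s : 𝔼)) 0) :
    HasDerivAt (fun s ↦ (U s : 𝔼)) (-sphGrad ψ v) 0 := by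
  have h0 : U 0 = v := (hU 0).eq_of_zero hψ
  have hG : ContinuousAt (fun s ↦ sphGrad ψ (U s)) 0 :=
    (contDiff_sphGrad hψ).continuous.continuousAt.comp hc
  have h1 : HasDerivAt (fun s ↦ s • sphGrad ψ (U s)) (sphGrad ψ v) 0 := by
    rw [hasDerivAt_iff_tendsto_slope]
    have : Tendsto (fun s ↦ sphGrad ψ (U s)) (𝓝[≠] 0) (𝓝 (sphGrad ψ v)) := by
      have := hG.tendsto.mono_left (nhdsWithin_le_nhds (s := {0}ᶜ))
      rwa [h0] at this
    refine this.congr' ?_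
    filter_upwards [self_mem_nhdsWithin] with s hs
    have hs' : s ≠ 0 := hs
    simp [slope, smul_smul, hs']
  have h2 : HasDerivAt (fun s ↦ √(1 + ‖s • sphGrad ψ (U s)‖ ^ 2)) 0 0 := by
    have h3 := ((h1.norm_sq).const_add 1).sqrt (by simp)
    simpa using h3
  have h3 := (h2.smul_const (v : 𝔼)).sub h1
  simp only [zero_smul, zero_sub] at h3
  refine h3.congr_of_eventuallyEq (Eventually.of_forall fun s ↦ ?_)
  simpa using (hU s).eq_sub hψ

theorem hasDerivAt_comp_contact {ψ : 𝔼 → ℝ} (hψ : ContDiff ℝ 2 ψ) {U : ℝ → 𝕊} {v : 𝕊}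
    (hU : ∀ s, IsContact ψ s v (U s)) (hc : ContinuousAt (fun s ↦ (U s : 𝔼)) 0) :
    HasDerivAt (fun s ↦ ψ (U s)) (-‖sphGrad ψ v‖ ^ 2) 0 := by
  have h0 : U 0 = v := (hU 0).eq_of_zero hψ
  have h1 : HasGradientAt ψ (gradient ψ (U 0)) (U 0) :=
    (hψ.differentiable (by norm_num) _).hasGradientAt
  have h2 := h1.hasFDerivAt.comp_hasDerivAt (0 : ℝ) (hasDerivAt_contact hψ hU hc)
  refine h2.congr_deriv ?_
  rw [h0]
  have h3 : gradient ψ (v : 𝔼) = sphGrad ψ v + ⟪gradient ψ (v : 𝔼), (v : 𝔼)⟫ • (v : 𝔼) := by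
    simp [sphGrad]
  rw [InnerProductSpace.toDual_apply_apply, inner_neg_right]
  nth_rewrite 1 [h3]
  rw [inner_add_left, inner_smul_left, inner_sphGrad_self, real_inner_self_eq_norm_sq]
  simp

end RadialFunction

section RadialWeight

/-- The radial mass `∫ r in 0..R * exp y, r ^ (n - 1) * f r` as a function of `y` has this
derivative. -/
def radialWeight (n : ℕ) (f : ℝ → ℝ) (R y : ℝ) : ℝ :=
  (R * Real.exp y) ^ n * f (R * Real.exp y)

variable {n : ℕ} {f : ℝ → ℝ} {R : ℝ}

theorem hasDerivAt_radialMass (hn : n ≠ 0) (hf : Continuous f) (y : ℝ) :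
    HasDerivAt (fun y ↦ ∫ r in (0 : ℝ)..R * Real.exp y, r ^ (n - 1) * f r)
      (radialWeight n f R y) y := by
  have hc : Continuous fun r : ℝ ↦ r ^ (n - 1) * f r := by fun_prop
  have h1 := intervalIntegral.integral_hasDerivAt_right
    (hc.intervalIntegrable 0 (R * Real.exp y)) hc.aestronglyMeasurable.stronglyMeasurableAtFilter
    hc.continuousAt
  have h2 := h1.comp y ((Real.hasDerivAt_exp y).const_mul R)
  refine h2.congr_deriv ?_
  rw [radialWeight, mul_right_comm, ← pow_succ, Nat.sub_add_cancel (Nat.pos_of_ne_zero hn)]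

theorem contDiff_radialWeight (hR : 0 < R) (hf : ContDiffOn ℝ 1 f (Ioi 0)) :
    ContDiff ℝ 1 (radialWeight n f R) := by
  have h1 : ContDiff ℝ 1 fun y ↦ R * Real.exp y := by fun_prop
  have h2 : ContDiff ℝ 1 fun y ↦ f (R * Real.exp y) :=
    hf.comp_contDiff h1 fun y ↦ mul_pos hR (Real.exp_pos y)
  exact (h1.pow n).mul h2

theorem hasDerivAt_radialWeight_zero (hn : n ≠ 0) {f' : ℝ} (hf : HasDerivAt f f' R) :
    HasDerivAt (radialWeight n f R) (R ^ n * (n * f R + R * f')) 0 := by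
  have h1 : HasDerivAt (fun y ↦ R * Real.exp y) R 0 := by
    simpa using (Real.hasDerivAt_exp 0).const_mul R
  have h2 : HasDerivAt (fun y ↦ f (R * Real.exp y)) (f' * R) 0 :=
    HasDerivAt.comp (0 : ℝ) (by simpa using hf) h1
  refine ((h1.pow n).mul h2).congr_deriv ?_
  obtain ⟨k, rfl⟩ := Nat.exists_eq_succ_of_ne_zero hn
  simp
  ring

end RadialWeight

section Variation

open Filter Topology

variable {n : ℕ}

local notation "𝔼" => EuclideanSpace ℝ (Fin n)
local notation "𝕊" => sphere (0 : EuclideanSpace ℝ (Fin n)) 1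
local notation "σ" => Measure.toSphere (volume : Measure (EuclideanSpace ℝ (Fin n)))

/-- The measure of the bodies with support data `R * exp (s * ψ)`, together with its first two
derivatives at `s = 0`. -/
theorem exists_hasDerivAt_measure_bodyOf (hn : n ≠ 0) {f : ℝ → ℝ} (hf : Continuous f)
    (hf0 : ∀ t, 0 ≤ f t) (hf1 : ContDiffOn ℝ 1 f (Ioi 0)) {R : ℝ} (hR : 0 < R)
    {ψ : 𝔼 → ℝ} (hψ : ContDiff ℝ 2 ψ) {g : ℝ → ℝ}
    (hg : ∀ s, g s = (((volume : Measure 𝔼).withDensity fun x ↦ ENNReal.ofReal (f ‖x‖))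
      (bodyOf fun u ↦ R * Real.exp (s * ψ u))).toReal) :
    g 0 = (σ univ).toReal * (∫ r in (0 : ℝ)..R, r ^ (n - 1) * f r) ∧
    ∃ g₁ : ℝ → ℝ, (∀ᶠ s in 𝓝 0, HasDerivAt g (g₁ s) s) ∧
      g₁ 0 = R ^ n * f R * ∫ u : 𝕊, ψ u ∂σ ∧
      HasDerivAt g₁ (R ^ n * ((n * f R + R * deriv f R) * (∫ u : 𝕊, ψ u ^ 2 ∂σ)
        - f R * ∫ u : 𝕊, ‖sphGrad ψ u‖ ^ 2 ∂σ)) 0 := by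
  choose U hU using fun s v ↦ exists_isContact hψ.continuous s v
  obtain ⟨δ, hδ, C, hC, hlip⟩ := exists_norm_contact_sub_le hψ
  set Λ : ℝ → 𝕊 → ℝ := fun s v ↦ logRadial ψ s v (U s v) with hΛ
  set W := radialWeight n f R with hW
  have hWd : ContDiff ℝ 1 W := contDiff_radialWeight hR hf1
  have hU0 : ∀ v, U 0 v = v := fun v ↦ (hU 0 v).eq_of_zero hψ
  have hΛ0 : ∀ v, Λ 0 v = 0 := fun v ↦ (hU 0 v).logRadial_of_zero hψ
  have hψc : Continuous fun u : 𝕊 ↦ ψ u := hψ.continuous.comp continuous_subtype_val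
  obtain ⟨M₀, hM₀⟩ := (isCompact_sphere (0 : 𝔼) 1).exists_bound_of_continuousOn
    hψ.continuous.continuousOn
  set M := max M₀ 0
  have hM : ∀ u : 𝕊, |ψ u| ≤ M := fun u ↦ (hM₀ u u.2).trans (le_max_left _ _)
  have hM0 : 0 ≤ M := le_max_right _ _
  obtain ⟨Lψ, hLψ⟩ := ((hψ.of_le (m := 1) (by norm_num)).locallyLipschitz.locallyLipschitzOn
    ).exists_lipschitzOnWith_of_compact (isCompact_sphere (0 : 𝔼) 1)
  -- Dependence of contact points on the parameter and on the direction.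
  have hUs : ∀ v s s', |s| ≤ δ → |s'| ≤ δ → ‖(U s v : 𝔼) - U s' v‖ ≤ C * |s - s'| := by
    intro v s s' hs hs'
    simpa using hlip s s' hs hs' v v _ _ (hU s v) (hU s' v)
  have hψs : ∀ v s s', |s| ≤ δ → |s'| ≤ δ →
      |ψ (U s v) - ψ (U s' v)| ≤ Lψ * C * |s - s'| := by
    intro v s s' hs hs'
    have h1 := hLψ.dist_le_mul _ (U s v).2 _ (U s' v).2
    rw [Real.dist_eq, dist_eq_norm] at h1
    calc _ ≤ _ := h1
      _ ≤ Lψ * (C * |s - s'|) := by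
        gcongr
        exact hUs v s s' hs hs'
      _ = _ := by ring
  have hUv : ∀ s, |s| ≤ δ → Continuous (U s) := by
    intro s hs
    refine (LipschitzWith.of_dist_le_mul (K := C.toNNReal) fun v v' ↦ ?_).continuous
    rw [Real.coe_toNNReal C hC]
    simpa [Subtype.dist_eq, dist_eq_norm] using hlip s s hs hs v v' _ _ (hU s v) (hU s v')
  have hΛv : ∀ s, |s| ≤ δ → Continuous (Λ s) := by
    intro s hs
    have h1 := hUv s hs
    have h2 : Continuous fun v : 𝕊 ↦ (U s v : 𝔼) := continuous_subtype_val.comp h1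
    have h3 : Continuous fun v : 𝕊 ↦ ⟪(U s v : 𝔼), (v : 𝔼)⟫ :=
      h2.inner continuous_subtype_val
    exact (continuous_const.mul (hψ.continuous.comp h2)).sub
      (h3.log fun v ↦ (hU s v).1.ne')
  have hΛs : ∀ v s s', |Λ s v - Λ s' v| ≤ M * |s - s'| := by
    intro v s s'
    have h1 := (hU s' v).logRadial_sub_le (hU s v)
    have h2 := (hU s v).logRadial_sub_le (hU s' v)
    have h3 : ∀ t : ℝ, ∀ u : 𝕊, t * ψ u ≤ M * |t| := fun t u ↦ by
      calc t * ψ u ≤ |t * ψ u| := le_abs_self _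
        _ = |ψ u| * |t| := by rw [abs_mul, mul_comm]
        _ ≤ _ := by gcongr; exact hM u
    rw [abs_le]
    constructor
    · have := h3 (s' - s) (U s v)
      rw [abs_sub_comm] at this
      linarith
    · linarith [h3 (s - s') (U s' v)]
  have hΛb : ∀ v s, |s| ≤ δ → Λ s v ∈ Icc (-(M * δ)) (M * δ) := by
    intro v s hs
    have := hΛs v s 0
    rw [hΛ0, sub_zero, sub_zero] at this
    exact abs_le.mp (this.trans (by gcongr))
  obtain ⟨B₀, hB₀⟩ := (isCompact_Icc (a := -(M * δ)) (b := M * δ)).exists_bound_of_continuousOn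
    hWd.continuous.continuousOn
  set B := max B₀ 0
  have hB : ∀ v s, |s| ≤ δ → |W (Λ s v)| ≤ B := fun v s hs ↦
    (hB₀ _ (hΛb v s hs)).trans (le_max_left _ _)
  have hB0 : 0 ≤ B := le_max_right _ _
  obtain ⟨LW, hLW⟩ := (hWd.locallyLipschitz.locallyLipschitzOn
    ).exists_lipschitzOnWith_of_compact (isCompact_Icc (a := -(M * δ)) (b := M * δ))
  have hUcont : ∀ v s, |s| < δ → ContinuousAt (fun t ↦ (U t v : 𝔼)) s := by
    intro v s hs
    rw [ContinuousAt, tendsto_iff_norm_sub_tendsto_zero]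
    have h1 : Tendsto (fun t : ℝ ↦ C * |t - s|) (𝓝 s) (𝓝 0) := by
      have : Continuous fun t : ℝ ↦ C * |t - s| := by fun_prop
      simpa using this.tendsto s
    refine squeeze_zero' (Eventually.of_forall fun _ ↦ norm_nonneg _) ?_ h1
    filter_upwards [continuous_abs.continuousAt.eventually (gt_mem_nhds hs)] with t ht
    exact hUs v t s ht.le hs.le
  have hΛd : ∀ v s, |s| < δ → HasDerivAt (fun t ↦ Λ t v) (ψ (U s v)) s := by
    intro v s hs
    refine hasDerivAt_of_envelope (p := fun t ↦ ψ (U t v))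
      (hψ.continuous.continuousAt.comp (hUcont v s hs)) (Eventually.of_forall fun t ↦ ?_)
    have h1 := (hU s v).logRadial_sub_le (hU t v)
    have h2 := (hU t v).logRadial_sub_le (hU s v)
    exact ⟨by linarith, h1⟩
  -- Polar coordinates.
  set P : ℝ → ℝ := fun y ↦ ∫ r in (0 : ℝ)..R * Real.exp y, r ^ (n - 1) * f r with hP
  have hPd : ∀ y, HasDerivAt P (W y) y := hasDerivAt_radialMass hn hf
  have hPc : Continuous P := continuous_iff_continuousAt.mpr fun y ↦ (hPd y).continuousAt
  have hgP : ∀ s, |s| ≤ δ → g s = ∫ v, P (Λ s v) ∂σ := by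
    intro s hs
    rw [hg]
    refine toReal_withDensity_eq_integral_sphere hf hf0 hn (isClosed_bodyOf _).measurableSet
      (ρ := fun v ↦ R * Real.exp (Λ s v)) ?_ (fun v ↦ by positivity) ?_
    · exact continuous_const.mul (Real.continuous_exp.comp (hΛv s hs))
    · intro v r hr
      exact (hU s v).smul_mem_bodyOf_iff hR hr
  have h_int : ∀ {h : 𝕊 → ℝ}, Continuous h → Integrable h σ := fun {h} hh ↦
    hh.integrable_of_hasCompactSupport (HasCompactSupport.of_compactSpace h)
  have hnhds : ∀ s : ℝ, |s| < δ → ∀ᶠ t in 𝓝 s, |t| < δ := fun s hs ↦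
    continuous_abs.continuousAt.eventually (gt_mem_nhds hs)
  have hδ0 : |(0 : ℝ)| < δ := by simpa using hδ
  refine ⟨?_, fun s ↦ ∫ v, W (Λ s v) * ψ (U s v) ∂σ, ?_, ?_, ?_⟩
  · rw [hgP 0 hδ0.le]
    simp [hΛ0, hP, measureReal_def]
  · filter_upwards [hnhds 0 hδ0] with s hs
    have hcs : ∀ t, |t| < δ → Continuous fun v ↦ W (Λ t v) * ψ (U t v) := fun t ht ↦
      (hWd.continuous.comp (hΛv t ht.le)).mul (hψc.comp (hUv t ht.le))
    have := (hasDerivAt_integral_of_dominated_loc_of_deriv_le (μ := σ)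
      (F := fun t v ↦ P (Λ t v)) (F' := fun t v ↦ W (Λ t v) * ψ (U t v)) (bound := fun _ ↦ B * M)
      (hnhds s hs) ?_ (h_int (hPc.comp (hΛv s hs.le))) (hcs s hs).aestronglyMeasurable
      ?_ (integrable_const _) ?_).2
    · refine this.congr_of_eventuallyEq ?_
      filter_upwards [hnhds s hs] with t ht using hgP t ht.le
    · filter_upwards [hnhds s hs] with t ht
      exact (hPc.comp (hΛv t ht.le)).aestronglyMeasurable
    · refine Eventually.of_forall fun v t ht ↦ ?_
      rw [norm_mul]
      exact mul_le_mul (hB v t (le_of_lt ht)) (hM _) (norm_nonneg _) hB0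
    · refine Eventually.of_forall fun v t ht ↦ ?_
      exact (hPd _).comp t (hΛd v t ht)
  · simp only [hΛ0, hU0]
    rw [integral_const_mul]
    simp [hW, radialWeight]
  · have hdf : HasDerivAt f (deriv f R) R :=
      ((hf1.contDiffAt (Ioi_mem_nhds hR)).differentiableAt (by norm_num)).hasDerivAt
    have hW0 := hasDerivAt_radialWeight_zero hn hdf
    set c := R ^ n * (n * f R + R * deriv f R)
    have hWval : W 0 = R ^ n * f R := by simp [hW, radialWeight]
    have hFd : Continuous fun v : 𝕊 ↦ c * ψ v ^ 2 - R ^ n * f R * ‖sphGrad ψ v‖ ^ 2 := by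
      have h1 : Continuous fun v : 𝕊 ↦ ‖sphGrad ψ v‖ :=
        ((contDiff_sphGrad hψ).continuous.comp continuous_subtype_val).norm
      fun_prop
    have h1 : Continuous fun v : 𝕊 ↦ ‖sphGrad ψ v‖ ^ 2 :=
      ((contDiff_sphGrad hψ).continuous.comp continuous_subtype_val).norm.pow 2
    have := (hasDerivAt_integral_of_dominated_loc_of_lip (μ := σ)
      (F := fun t v ↦ W (Λ t v) * ψ (U t v))
      (F' := fun v : 𝕊 ↦ c * ψ v ^ 2 - R ^ n * f R * ‖sphGrad ψ v‖ ^ 2)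
      (bound := fun _ ↦ LW * M * M + B * (Lψ * C)) (hnhds 0 hδ0) ?_ ?_ ?_ ?_ (integrable_const _)
      ?_).2
    · refine this.congr_deriv ?_
      rw [integral_sub (h_int (by fun_prop)) (h_int (by fun_prop)), integral_const_mul,
        integral_const_mul]
      ring
    · filter_upwards [hnhds 0 hδ0] with t ht
      exact ((hWd.continuous.comp (hΛv t ht.le)).mul
        (hψc.comp (hUv t ht.le))).aestronglyMeasurable
    · exact h_int ((hWd.continuous.comp (hΛv 0 hδ0.le)).mul (hψc.comp (hUv 0 hδ0.le)))
    · exact hFd.aestronglyMeasurable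
    · refine Eventually.of_forall fun v ↦ LipschitzOnWith.of_dist_le_mul fun s hs t ht ↦ ?_
      have hs' : |s| ≤ δ := le_of_lt hs
      have ht' : |t| ≤ δ := le_of_lt ht
      rw [Real.coe_nnabs, abs_of_nonneg (by positivity), Real.dist_eq, Real.dist_eq]
      have e : W (Λ s v) * ψ (U s v) - W (Λ t v) * ψ (U t v) =
          (W (Λ s v) - W (Λ t v)) * ψ (U s v) + W (Λ t v) * (ψ (U s v) - ψ (U t v)) := by ring
      have h2 : |W (Λ s v) - W (Λ t v)| ≤ LW * (M * |s - t|) := by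
        have := hLW.dist_le_mul _ (hΛb v s hs') _ (hΛb v t ht')
        rw [Real.dist_eq, Real.dist_eq] at this
        exact this.trans (mul_le_mul_of_nonneg_left (hΛs v s t) LW.2)
      rw [e]
      refine (abs_add_le _ _).trans ?_
      rw [abs_mul, abs_mul]
      calc _ ≤ LW * (M * |s - t|) * M + B * (Lψ * C * |s - t|) := by
            gcongr
            exacts [hM _, hB v t ht', hψs v s t hs' ht']
        _ = _ := by ring
    · refine Eventually.of_forall fun v ↦ ?_
      have h2 : HasDerivAt (fun t ↦ W (Λ t v)) (c * ψ v) 0 := by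
        have := HasDerivAt.comp (h₂ := W) (h₂' := c) (0 : ℝ) (by rw [hΛ0]; exact hW0)
          (hΛd v 0 hδ0)
        rwa [hU0] at this
      have h3 := hasDerivAt_comp_contact hψ (fun s ↦ hU s v) (hUcont v 0 hδ0)
      refine (h2.mul h3).congr_deriv ?_
      rw [hU0, hΛ0, hWval]
      ring

end Variation

section LogSecondDerivative

open Filter Topology

theorem deriv_deriv_log_of_pos {g g₁ : ℝ → ℝ} {g₂ : ℝ}
    (hg : ∀ᶠ s in 𝓝 0, HasDerivAt g (g₁ s) s) (hg₁ : HasDerivAt g₁ g₂ 0) (h0 : 0 < g 0) :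
    deriv (deriv fun s ↦ Real.log (g s)) 0 = (g₂ * g 0 - g₁ 0 * g₁ 0) / g 0 ^ 2 := by
  have hpos : ∀ᶠ s in 𝓝 0, 0 < g s :=
    hg.self_of_nhds.continuousAt.eventually (lt_mem_nhds h0)
  have hev : deriv (fun s ↦ Real.log (g s)) =ᶠ[𝓝 0] fun s ↦ g₁ s / g s := by
    filter_upwards [hg, hpos] with s hs hs0
    exact (hs.log hs0.ne').deriv
  rw [hev.deriv_eq]
  exact (hg₁.div hg.self_of_nhds h0.ne').deriv

theorem deriv_deriv_log_of_eq_zero {g g₁ : ℝ → ℝ} (hg : ∀ᶠ s in 𝓝 0, HasDerivAt g (g₁ s) s)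
    (hnonneg : ∀ s, 0 ≤ g s) (h0 : g 0 = 0) :
    deriv (deriv fun s ↦ Real.log (g s)) 0 = 0 := by
  set D := deriv fun s ↦ Real.log (g s) with hD
  by_cases hdiff : DifferentiableAt ℝ D 0
  swap
  · exact deriv_zero_of_not_differentiableAt hdiff
  have hbd : ∀ᶠ s in 𝓝 0, |D s| < |D 0| + 1 :=
    hdiff.continuousAt.abs.eventually (gt_mem_nhds (lt_add_one _))
  obtain ⟨ε, hε, hball⟩ := Metric.eventually_nhds_iff.mp (hg.and hbd)
  have hbound : ∀ s, |s| < ε → |g₁ s| ≤ (|D 0| + 1) * |g s| := by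
    intro s hs
    obtain ⟨h1, h2⟩ := hball (y := s) (by simpa using hs)
    rcases eq_or_ne (g s) 0 with h3 | h3
    · have hmin : IsLocalMin g s := Eventually.of_forall fun t ↦ by
        rw [h3]
        exact hnonneg t
      rw [hmin.hasDerivAt_eq_zero h1, h3]
      simp
    · have h4 : D s = g₁ s / g s := (h1.log h3).deriv
      have h5 : g₁ s = D s * g s := by
        rw [h4]
        field_simp
      rw [h5, abs_mul]
      gcongr
  have hzero : ∀ s, |s| ≤ ε / 2 → g s = 0 := by
    have hlt : ∀ x ∈ Icc 0 (ε / 2), |x| < ε := fun x hx ↦ by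
      rw [abs_of_nonneg hx.1]
      linarith [hx.2]
    have hpos : ∀ x ∈ Icc 0 (ε / 2), g x = 0 := by
      have hd : ∀ x ∈ Icc 0 (ε / 2), HasDerivAt g (g₁ x) x := fun x hx ↦
        (hball (by simpa using hlt x hx)).1
      exact eq_zero_of_abs_deriv_le_mul_abs_self_of_eq_zero_right (f' := g₁) (K := |D 0| + 1)
        (fun x hx ↦ (hd x hx).continuousAt.continuousWithinAt)
        (fun x hx ↦ (hd x (Ico_subset_Icc_self hx)).hasDerivWithinAt) h0
        (fun x hx ↦ hbound x (hlt x (Ico_subset_Icc_self hx)))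
    have hneg : ∀ x ∈ Icc 0 (ε / 2), g (-x) = 0 := by
      have hd : ∀ x ∈ Icc 0 (ε / 2), HasDerivAt (fun y ↦ g (-y)) (-g₁ (-x)) x := fun x hx ↦ by
        have := (hball (y := -x) (by simpa using hlt x hx)).1
        exact (this.scomp x (hasDerivAt_neg x)).congr_deriv (by simp)
      exact eq_zero_of_abs_deriv_le_mul_abs_self_of_eq_zero_right (f := fun y ↦ g (-y))
        (f' := fun y ↦ -g₁ (-y)) (K := |D 0| + 1)
        (fun x hx ↦ (hd x hx).continuousAt.continuousWithinAt)
        (fun x hx ↦ (hd x (Ico_subset_Icc_self hx)).hasDerivWithinAt) (by simpa using h0)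
        (fun x hx ↦ by
          simpa using hbound (-x) (by simpa using hlt x (Ico_subset_Icc_self hx)))
    intro s hs
    rcases le_total 0 s with h | h
    · exact hpos s ⟨h, by rwa [abs_of_nonneg h] at hs⟩
    · simpa using hneg (-s) ⟨by linarith, by rwa [abs_of_nonpos h] at hs⟩
  have hlog : (fun s ↦ Real.log (g s)) =ᶠ[𝓝 0] fun _ ↦ 0 := by
    filter_upwards [Metric.closedBall_mem_nhds (0 : ℝ) (half_pos hε)] with s hs
    rw [hzero s (by simpa using hs), Real.log_zero]
  have := hlog.deriv.deriv_eq
  rw [hD, this]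
  simp

end LogSecondDerivative

section SmoothLog

/-- A smooth function on the line that agrees with the logarithm on `[m, ∞)`. -/
def smoothLog (m t : ℝ) : ℝ :=
  Real.smoothTransition (2 * t / m - 1) * Real.log t

theorem smoothLog_of_le {m t : ℝ} (hm : 0 < m) (ht : m ≤ t) : smoothLog m t = Real.log t := by
  rw [smoothLog, Real.smoothTransition.one_of_one_le, one_mul]
  rw [le_sub_iff_add_le, le_div_iff₀ hm]
  linarith

theorem contDiff_smoothLog {m : ℝ} (hm : 0 < m) {k : ℕ∞} : ContDiff ℝ k (smoothLog m) := by
  rw [contDiff_iff_contDiffAt]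
  intro t
  rcases lt_or_ge t (m / 2) with ht | ht
  · refine contDiffAt_const (c := (0 : ℝ)) |>.congr_of_eventuallyEq ?_
    filter_upwards [gt_mem_nhds ht] with y hy
    rw [smoothLog, Real.smoothTransition.zero_of_nonpos, zero_mul]
    rw [sub_nonpos, div_le_one hm]
    linarith
  · have ht0 : t ≠ 0 := by linarith
    have h1 : ContDiffAt ℝ k (fun y : ℝ ↦ 2 * y / m - 1) t := by fun_prop
    exact (Real.smoothTransition.contDiffAt.comp t h1).mul (Real.contDiffAt_log.mpr ht0)

end SmoothLog

section Criterion

open Filter Topology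

variable {n : ℕ}

local notation "𝔼" => EuclideanSpace ℝ (Fin n)
local notation "𝕊" => sphere (0 : EuclideanSpace ℝ (Fin n)) 1
local notation "σ" => Measure.toSphere (volume : Measure (EuclideanSpace ℝ (Fin n)))

theorem bodyOf_congr {h₁ h₂ : 𝔼 → ℝ} (h : ∀ u ∈ sphere (0 : 𝔼) 1, h₁ u = h₂ u) :
    bodyOf h₁ = bodyOf h₂ := by
  ext x
  exact forall₂_congr fun u hu ↦ by rw [h u hu]

theorem integral_pow_mul_eq_pow_mul_integral (hn : n ≠ 0) (f : ℝ → ℝ) (R : ℝ) :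
    ∫ r in (0 : ℝ)..R, r ^ (n - 1) * f r =
      R ^ n * ∫ t in (0 : ℝ)..1, t ^ (n - 1) * f (R * t) := by
  have h1 := intervalIntegral.mul_integral_comp_mul_left (a := 0) (b := 1)
    (f := fun r ↦ r ^ (n - 1) * f r) R
  simp only [mul_zero, mul_one] at h1
  rw [← h1, ← intervalIntegral.integral_const_mul, ← intervalIntegral.integral_const_mul]
  congr 1 with t
  obtain ⟨k, rfl⟩ := Nat.exists_eq_succ_of_ne_zero hn
  simp only [Nat.succ_eq_add_one, Nat.add_sub_cancel]
  ring

theorem deriv_deriv_log_measure_nonpos_iff (hn : n ≠ 0) {f : ℝ → ℝ}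
    (hf : ContDiffOn ℝ 2 f (Ici 0)) (hf0 : ∀ t ∈ Ici (0 : ℝ), 0 ≤ f t) {R : ℝ} (hR : 0 < R)
    {A : ℝ} (hA : A = ∫ t in (0 : ℝ)..1, t ^ (n - 1) * f (R * t))
    {ψ : 𝔼 → ℝ} (hψ : ContDiff ℝ 2 ψ) :
    deriv (deriv fun s : ℝ ↦ Real.log
      (((volume : Measure 𝔼).withDensity fun x ↦ ENNReal.ofReal (f ‖x‖))
        (bodyOf fun u ↦ R * Real.exp (s * ψ u))).toReal) 0 ≤ 0 ↔
    A * (n * f R + R * deriv f R) * (1 / (σ univ).toReal) * (∫ u : 𝕊, ψ u ^ 2 ∂σ)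
      - A * f R * (1 / (σ univ).toReal) * (∫ u : 𝕊, ‖sphGrad ψ u‖ ^ 2 ∂σ) ≤
    f R ^ 2 * (1 / (σ univ).toReal * ∫ u : 𝕊, ψ u ∂σ) ^ 2 := by
  have : Nonempty (Fin n) := ⟨⟨0, Nat.pos_of_ne_zero hn⟩⟩
  set F : ℝ → ℝ := fun t ↦ f (max t 0) with hF
  have hFf : ∀ t, 0 ≤ t → F t = f t := fun t ht ↦ by simp [hF, ht]
  have hFc : Continuous F :=
    hf.continuousOn.comp_continuous (by fun_prop) fun t ↦ le_max_right t 0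
  have hF0 : ∀ t, 0 ≤ F t := fun t ↦ hf0 _ (le_max_right t 0)
  have hF1 : ContDiffOn ℝ 1 F (Ioi 0) :=
    ((hf.of_le (by norm_num)).mono Ioi_subset_Ici_self).congr fun t ht ↦ hFf t (le_of_lt ht)
  have hFd : deriv F R = deriv f R := by
    apply EventuallyEq.deriv_eq
    filter_upwards [lt_mem_nhds hR] with t ht using hFf t ht.le
  have hFR : F R = f R := hFf R hR.le
  set g : ℝ → ℝ := fun s ↦ (((volume : Measure 𝔼).withDensity fun x ↦ ENNReal.ofReal (f ‖x‖))
        (bodyOf fun u ↦ R * Real.exp (s * ψ u))).toReal with hg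
  have hgF : ∀ s, g s = (((volume : Measure 𝔼).withDensity fun x ↦ ENNReal.ofReal (F ‖x‖))
        (bodyOf fun u ↦ R * Real.exp (s * ψ u))).toReal := by
    intro s
    simp only [hg, hFf _ (norm_nonneg _)]
  obtain ⟨hg0, g₁, hgd, hg₁0, hg₁d⟩ := exists_hasDerivAt_measure_bodyOf hn hFc hF0 hF1 hR hψ hgF
  rw [hFR, hFd] at hg₁d
  rw [hFR] at hg₁0
  have hAint : ∫ r in (0 : ℝ)..R, r ^ (n - 1) * F r = R ^ n * A := by
    rw [hA, ← integral_pow_mul_eq_pow_mul_integral hn]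
    refine intervalIntegral.integral_congr fun t ht ↦ ?_
    rw [uIcc_of_le hR.le] at ht
    simp only [hFf t ht.1]
  rw [hAint] at hg0
  have hA0 : 0 ≤ A := by
    rw [hA]
    exact intervalIntegral.integral_nonneg zero_le_one fun t ht ↦
      mul_nonneg (pow_nonneg ht.1 _) (hf0 _ (mul_nonneg hR.le ht.1))
  have hS : 0 < (σ univ).toReal := ENNReal.toReal_pos
    (Measure.measure_univ_ne_zero.mpr (Measure.toSphere_ne_zero _)) (measure_ne_top _ _)
  set S := (σ univ).toReal
  set I₁ := ∫ u : 𝕊, ψ u ∂σ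
  set I₂ := ∫ u : 𝕊, ψ u ^ 2 ∂σ
  set I₃ := ∫ u : 𝕊, ‖sphGrad ψ u‖ ^ 2 ∂σ
  have hRn : 0 < R ^ n := pow_pos hR n
  rcases hA0.eq_or_lt with hA' | hA'
  · have h0 : g 0 = 0 := by rw [hg0, ← hA']; ring
    rw [deriv_deriv_log_of_eq_zero hgd (fun s ↦ ENNReal.toReal_nonneg) h0, ← hA']
    simp only [le_refl, zero_mul, sub_zero, true_iff]
    positivity
  · have h0 : 0 < g 0 := by rw [hg0]; positivity
    rw [deriv_deriv_log_of_pos hgd hg₁d h0, div_le_iff₀ (by positivity), zero_mul, hg₁0, hg0]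
    have e1 : R ^ n * ((n * f R + R * deriv f R) * I₂ - f R * I₃) * (S * (R ^ n * A))
        - R ^ n * f R * I₁ * (R ^ n * f R * I₁) =
        (R ^ n) ^ 2 * S ^ 2 * ((A * (n * f R + R * deriv f R) * (1 / S) * I₂
          - A * f R * (1 / S) * I₃) - f R ^ 2 * (1 / S * I₁) ^ 2) := by
      field_simp
    have hpos : 0 < (R ^ n) ^ 2 * S ^ 2 := by positivity
    rw [e1, ← sub_nonpos (b := f R ^ 2 * (1 / S * I₁) ^ 2)]
    exact ⟨fun h ↦ nonpos_of_mul_nonpos_right h hpos, mul_nonpos_of_nonneg_of_nonpos hpos.le⟩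

end Criterion

/-- **Lemma 5 (Lemma L-T-2).** For a rotation invariant measure `γ` with density `f(|x|)`
and `h_K = R`, the infinitesimal log-Brunn-Minkowski condition
`(d²/ds²) log γ(Q_s)|_{s=0} ≤ 0` along every family `Q(R,φ,I)` with `φ` even and strictly
positive is equivalent to the integral inequality (ii) for every even `ψ ∈ C²(𝕊ⁿ⁻¹)`. -/
theorem log_BM_second_derivative_condition_iff (n : ℕ) (hn : 2 ≤ n)
    (γ : Measure (EuclideanSpace ℝ (Fin n)))
    (f : ℝ → ℝ) (hf : ContDiffOn ℝ 2 f (Ici 0)) (hfpos : ∀ t ∈ Ici (0:ℝ), 0 ≤ f t)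
    (hγ : γ = volume.withDensity (fun x => ENNReal.ofReal (f ‖x‖)))
    (R : ℝ) (hR : 0 < R)
    (A : ℝ) (hA : A = ∫ t in (0:ℝ)..1, t ^ (n - 1) * f (R * t)) :
    -- (i) the second-order condition along every family Q(R, φ, I), φ even positive
    (∀ φ : EuclideanSpace ℝ (Fin n) → ℝ, ContDiff ℝ 2 φ →
        (∀ u ∈ sphere (0 : EuclideanSpace ℝ (Fin n)) 1, φ (-u) = φ u) →
        (∀ u ∈ sphere (0 : EuclideanSpace ℝ (Fin n)) 1, 0 < φ u) →
        deriv (deriv (fun s : ℝ =>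
          Real.log ((γ (bodyOf (fun u => R * φ u ^ s))).toReal))) 0 ≤ 0)
    ↔
    -- (ii) the integral inequality on the sphere for every even ψ
    (∀ ψ : EuclideanSpace ℝ (Fin n) → ℝ, ContDiff ℝ 2 ψ →
        (∀ u ∈ sphere (0 : EuclideanSpace ℝ (Fin n)) 1, ψ (-u) = ψ u) →
        A * ((n:ℝ) * f R + R * deriv f R)
            * (1 / (((volume : Measure (EuclideanSpace ℝ (Fin n))).toSphere univ).toReal))
            * (∫ u : sphere (0 : EuclideanSpace ℝ (Fin n)) 1, (ψ ↑u) ^ 2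
                ∂((volume : Measure (EuclideanSpace ℝ (Fin n))).toSphere))
          - A * f R
              * (1 / (((volume : Measure (EuclideanSpace ℝ (Fin n))).toSphere univ).toReal))
              * (∫ u : sphere (0 : EuclideanSpace ℝ (Fin n)) 1, ‖sphGrad ψ ↑u‖ ^ 2
                  ∂((volume : Measure (EuclideanSpace ℝ (Fin n))).toSphere))
        ≤ (f R) ^ 2
            * ((1 / (((volume : Measure (EuclideanSpace ℝ (Fin n))).toSphere univ).toReal))
                * ∫ u : sphere (0 : EuclideanSpace ℝ (Fin n)) 1, ψ ↑u
                    ∂((volume : Measure (EuclideanSpace ℝ (Fin n))).toSphere)) ^ 2) := by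
  have hn0 : n ≠ 0 := by omega
  subst hγ
  constructor
  · intro h ψ hψ hev
    rw [← deriv_deriv_log_measure_nonpos_iff hn0 hf hfpos hR hA hψ]
    have := h (fun u ↦ Real.exp (ψ u)) hψ.exp (fun u hu ↦ by rw [hev u hu])
      (fun u _ ↦ Real.exp_pos _)
    simpa only [← Real.exp_mul, mul_comm (ψ _)] using this
  · intro h φ hφ hev hpos
    obtain ⟨m, hm, hmφ⟩ : ∃ m > 0, ∀ u ∈ sphere (0 : EuclideanSpace ℝ (Fin n)) 1, m ≤ φ u := by
      exact (isCompact_sphere (0 : EuclideanSpace ℝ (Fin n)) 1).exists_forall_le'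
        hφ.continuous.continuousOn hpos
    have hψ : ContDiff ℝ 2 fun u ↦ smoothLog m (φ u) :=
      (contDiff_smoothLog hm (k := 2)).comp hφ
    have key := (deriv_deriv_log_measure_nonpos_iff hn0 hf hfpos hR hA hψ).mpr
      (h _ hψ fun u hu ↦ by rw [hev u hu])
    have hbody : ∀ s : ℝ, bodyOf (fun u ↦ R * φ u ^ s) =
        bodyOf (fun u ↦ R * Real.exp (s * smoothLog m (φ u))) := fun s ↦
      bodyOf_congr fun u hu ↦ by
        rw [smoothLog_of_le hm (hmφ u hu), Real.rpow_def_of_pos (hpos u hu), mul_comm s]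
    simpa only [hbody] using key
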